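/- Let p ≥ 2 and n ≥ 2 be integers, E ∈ ℤ[X] a monic polynomial of degree n that is irreducible over ℚ, γ ∈ {0, …, p−1} with E(γ) ≡ 0 (mod p), and L the associated lattice. Let V = (v_0, …, v_{n−1}) ∈ L be a nonzero vector and V(X) = Σ_{i=0}^{n−1} v_i X^i. For 0 ≤ i ≤ n−1, let B_i ∈ ℤ^n be the coefficient vector of the polynomial X^i·V(X) mod E(X). Then the vectors B_0, …, B_{n−1} are linearly independent over ℚ and each B_i belongs to L; consequently they generate a rank-n sublattice L′ ⊆ L which contains V. -/

import Mathlib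

open Polynomial

theorem coeff_sum_fin_C_mul_X_pow {R : Type*} [Semiring R] {n : ℕ} (a : Fin n → R) (j : Fin n) :
    (∑ k, C (a k) * X ^ (k : ℕ)).coeff (j : ℕ) = a j := by
  simp [finsetSum_coeff, coeff_C_mul, coeff_X_pow, Fin.val_inj]

theorem sum_fin_coeff_mul_pow_eq_eval {R : Type*} [Semiring R] {n : ℕ} {P : R[X]}
    (hP : P.degree < n) (x : R) : ∑ j : Fin n, P.coeff j * x ^ (j : ℕ) = P.eval x := by
  rw [eval_eq_sum, ← sum_fin (fun i c => c * x ^ i) (by simp) hP]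

theorem dvd_eval_modByMonic {R : Type*} [CommRing R] {E P : R[X]} {d x : R}
    (hE : d ∣ E.eval x) (hP : d ∣ P.eval x) : d ∣ (P %ₘ E).eval x := by
  rw [modByMonic_eq_sub_mul_div, eval_sub, eval_mul]
  exact dvd_sub hP (hE.mul_right _)

theorem linearIndependent_coeff_X_pow_mul_modByMonic {K : Type*} [Field K] {n : ℕ} {E V : K[X]}
    (hE : E.Monic) (hirr : Irreducible E) (hdeg : E.degree = n) (hV : V ≠ 0)
    (hVdeg : V.degree < n) :
    LinearIndependent K
      (fun i j : Fin n => ((X ^ (i : ℕ) * V) %ₘ E).coeff (j : ℕ)) := by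
  rw [Fintype.linearIndependent_iff]
  intro g hg
  set G : K[X] := ∑ k, C (g k) * X ^ (k : ℕ) with hG
  have hsum : (G * V) %ₘ E = ∑ i : Fin n, g i • ((X ^ (i : ℕ) * V) %ₘ E) := by
    rw [hG, Finset.sum_mul]
    simp only [← modByMonicHom_apply, map_sum, ← map_smul, mul_assoc, smul_eq_C_mul]
  have hzero : (G * V) %ₘ E = 0 := by
    ext m
    by_cases hm : m < n
    · have := congrFun hg ⟨m, hm⟩
      simpa [hsum, finsetSum_coeff] using this
    · refine coeff_eq_zero_of_degree_lt ((degree_modByMonic_lt _ hE).trans_le ?_)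
      rw [hdeg]
      exact_mod_cast not_lt.mp hm
  have hnot : ∀ P : K[X], P.degree < n → E ∣ P → P = 0 := fun P hP h =>
    eq_zero_of_dvd_of_degree_lt h (hdeg ▸ hP)
  have hG0 : G = 0 := by
    rcases hirr.prime.dvd_or_dvd ((modByMonic_eq_zero_iff_dvd hE).mp hzero) with h | h
    · exact hnot G (degree_sum_fin_lt g) h
    · exact absurd (hnot V hVdeg h) hV
  intro i
  rw [← coeff_sum_fin_C_mul_X_pow g i, ← hG, hG0, coeff_zero]

/-- Corollary (sublattice from any nonzero vector, `E` irreducible): let `p ≥ 2`, `n ≥ 2`,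
`E ∈ ℤ[X]` monic of degree `n` irreducible over `ℚ`, `γ ∈ {0, …, p−1}` with
`E(γ) ≡ 0 (mod p)`, and `L = {v ∈ ℤ^n : Σ v_i γ^i ≡ 0 (mod p)}`.  Let `V ∈ L` be nonzero
and let `B_i` be the coefficient vector of `X^i · V(X) mod E(X)`.  Then `B_0, …, B_{n−1}`
are linearly independent over `ℚ`, each `B_i ∈ L`, and `V` lies in the sublattice they
generate. -/
theorem sublattice_of_vector_of_irreducible (p n : ℕ) (hp : 2 ≤ p) (hn : 2 ≤ n)
    (E : Polynomial ℤ) (hE : E.Monic) (hdeg : E.natDegree = n)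
    (hirr : Irreducible (E.map (Int.castRingHom ℚ)))
    (γ : ℤ) (hγ0 : 0 ≤ γ) (hγp : γ < (p : ℤ))
    (hroot : (p : ℤ) ∣ E.eval γ)
    (V : Fin n → ℤ) (hVne : V ≠ 0)
    (hVL : (p : ℤ) ∣ ∑ i, V i * γ ^ (i : ℕ))
    (B : Fin n → Fin n → ℤ)
    (hB : ∀ i j, B i j =
      ((X ^ (i : ℕ) * ∑ k, C (V k) * X ^ (k : ℕ)) %ₘ E).coeff (j : ℕ)) :
    LinearIndependent ℚ (fun i : Fin n => fun j : Fin n => (B i j : ℚ)) ∧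
    (∀ i, (p : ℤ) ∣ ∑ j, B i j * γ ^ (j : ℕ)) ∧
    V ∈ Submodule.span ℤ (Set.range B) := by
  have hE1 : E.degree = n := by rw [degree_eq_natDegree hE.ne_zero, hdeg]
  set P : ℤ[X] := ∑ k, C (V k) * X ^ (k : ℕ) with hP
  have hPdeg : P.degree < n := degree_sum_fin_lt V
  have hPcoeff : ∀ j : Fin n, P.coeff j = V j := coeff_sum_fin_C_mul_X_pow V
  have hP0 : P ≠ 0 := by
    intro h
    refine hVne (funext fun j => ?_)
    rw [← hPcoeff j, h, coeff_zero, Pi.zero_apply]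
  have hinj : Function.Injective (Int.castRingHom ℚ) := Int.cast_injective
  refine ⟨?_, fun i => ?_, ?_⟩
  · have key := linearIndependent_coeff_X_pow_mul_modByMonic (n := n)
      (V := P.map (Int.castRingHom ℚ)) (hE.map (Int.castRingHom ℚ)) hirr
      (by rw [degree_map_eq_of_injective hinj, hE1])
      ((Polynomial.map_ne_zero_iff hinj).mpr hP0)
      (by rwa [degree_map_eq_of_injective hinj])
    have hcast : (fun i j : Fin n => (B i j : ℚ)) = fun i j : Fin n =>
        ((X ^ (i : ℕ) * P.map (Int.castRingHom ℚ)) %ₘ E.map (Int.castRingHom ℚ)).coeff (j : ℕ) := by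
      funext i j
      rw [hB, ← Polynomial.map_X (Int.castRingHom ℚ), ← Polynomial.map_pow,
        ← Polynomial.map_mul, ← map_modByMonic _ hE, coeff_map, eq_intCast]
    rw [hcast]
    exact key
  · simp only [hB]
    rw [sum_fin_coeff_mul_pow_eq_eval (hE1 ▸ degree_modByMonic_lt _ hE)]
    refine dvd_eval_modByMonic hroot ?_
    rw [eval_mul]
    refine Dvd.dvd.mul_left ?_ _
    simpa [hP, eval_finsetSum] using hVL
  · refine Submodule.subset_span ⟨⟨0, by lia⟩, funext fun j => ?_⟩
    rw [hB, pow_zero, one_mul, (modByMonic_eq_self_iff hE).mpr (hE1 ▸ hPdeg), hPcoeff]
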